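/- Let Y ∈ ℝ^{m×n} with s = min(m,n), and suppose Y = U·Σ·Vᵀ where U ∈ ℝ^{m×m} and V ∈ ℝ^{n×n} are orthogonal matrices and Σ ∈ ℝ^{m×n} is zero off the diagonal with diagonal entries Σ_{11} ≥ Σ_{22} ≥ ⋯ ≥ Σ_{ss} ≥ 0. Let λ > 0 and let weights satisfy 0 ≤ w_1 ≤ w_2 ≤ ⋯ ≤ w_s. Define D = U·S_{λw}(Σ)·Vᵀ, where S_{λw}(Σ) ∈ ℝ^{m×n} is zero off the diagonal with i-th diagonal entry max(Σ_{ii} − λ·w_i, 0). Then D is a global minimizer of the function X ↦ λ·Σ_{i=1}^s w_i·σ_i(X) + (1/2)·‖X − Y‖_F² over all X ∈ ℝ^{m×n} (weighted singular value thresholding). -/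

import Mathlib

open Matrix

/-- Squared Frobenius norm of a real matrix. -/
noncomputable def frobNormSq {m n : ℕ} (A : Matrix (Fin m) (Fin n) ℝ) : ℝ :=
  ∑ i, ∑ j, (A i j) ^ 2

/-- The singular values of a real `m × n` matrix `A`, arranged in nonincreasing order:
the square roots of the eigenvalues of `A * Aᵀ`, sorted in nonincreasing order. -/
noncomputable def singularValues {m n : ℕ} (A : Matrix (Fin m) (Fin n) ℝ) :
    Fin (min m n) → ℝ := fun i =>
  Real.sqrt
    ((Matrix.isHermitian_mul_conjTranspose_self A).eigenvalues
      (Tuple.sort (fun j => -(Matrix.isHermitian_mul_conjTranspose_self A).eigenvalues j)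
        (Fin.castLE (min_le_left m n) i)))

theorem sum_castLE {s m : ℕ} (h : s ≤ m) (f : Fin m → ℝ) :
    ∑ i : Fin s, f (Fin.castLE h i) = ∑ k : Fin m, if (k : ℕ) < s then f k else 0 := by
  refine Fintype.sum_of_injective (Fin.castLE h) (Fin.castLE_injective h) _ _ ?_ ?_
  · intro k hk
    rw [if_neg]
    exact fun hks => hk ⟨⟨k, hks⟩, rfl⟩
  · intro i
    simp

theorem sum_castLE_le {s m : ℕ} (h : s ≤ m) (f : Fin m → ℝ) (hf : ∀ k, 0 ≤ f k) :
    ∑ i : Fin s, f (Fin.castLE h i) ≤ ∑ k : Fin m, f k := by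
  rw [sum_castLE]
  refine Finset.sum_le_sum fun k _ => ?_
  split_ifs
  exacts [le_rfl, hf k]

/-- The sum of a rectangular array vanishing off the diagonal is the sum of its diagonal. -/
theorem sum_sum_eq_sum_diag {m n : ℕ} (F : Fin m → Fin n → ℝ)
    (hF : ∀ (i : Fin m) (j : Fin n), (i : ℕ) ≠ (j : ℕ) → F i j = 0) :
    ∑ i, ∑ j, F i j = ∑ i : Fin (min m n),
      F (Fin.castLE (min_le_left m n) i) (Fin.castLE (min_le_right m n) i) := by
  rw [← Fintype.sum_prod_type']
  symm
  refine Fintype.sum_of_injective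
    (fun i : Fin (min m n) =>
      (Fin.castLE (min_le_left m n) i, Fin.castLE (min_le_right m n) i)) ?_ _ _ ?_ ?_
  · intro i j hij
    exact Fin.castLE_injective (min_le_left m n) (Prod.ext_iff.1 hij).1
  · rintro ⟨i, j⟩ hij
    refine hF i j fun h => hij ⟨⟨i, lt_min i.2 (h ▸ j.2)⟩, ?_⟩
    ext <;> simp [h]
  · intro i
    rfl

theorem mul_sum_le_sum_mul_of_partial_sums_nonneg {m : ℕ} (a z : Fin m → ℝ) (c : ℝ)
    (ha : Antitone a) (hca : ∀ i, c ≤ a i)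
    (hz : ∀ p : ℕ, 0 ≤ ∑ i : Fin m, if (i : ℕ) < p then z i else 0) :
    c * ∑ i, z i ≤ ∑ i, a i * z i := by
  induction m generalizing c with
  | zero => simp
  | succ m ih =>
    have h_all : 0 ≤ ∑ i, z i := by
      refine (hz (m + 1)).trans_eq (Finset.sum_congr rfl fun i _ => if_pos i.2)
    have h := ih (fun i => a i.castSucc) (fun i => z i.castSucc) (a (Fin.last m))
      (fun i j hij => ha (Fin.castSucc_le_castSucc_iff.2 hij)) (fun i => ha (Fin.le_last _))
      (fun p => by
        refine (hz (min p m)).trans_eq ?_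
        rw [Fin.sum_univ_castSucc]
        simp)
    rw [Fin.sum_univ_castSucc] at h_all ⊢
    rw [Fin.sum_univ_castSucc (fun i => a i * z i)]
    nlinarith [mul_le_mul_of_nonneg_right (hca (Fin.last m)) h_all]

theorem sum_mul_le_sum_mul_of_partial_sums_le {m : ℕ} (a x y : Fin m → ℝ)
    (ha : Antitone a) (ha0 : ∀ i, 0 ≤ a i)
    (h : ∀ p : ℕ, (∑ i : Fin m, if (i : ℕ) < p then x i else 0) ≤
      ∑ i : Fin m, if (i : ℕ) < p then y i else 0) :
    ∑ i, a i * x i ≤ ∑ i, a i * y i := by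
  have := mul_sum_le_sum_mul_of_partial_sums_nonneg a (fun i => y i - x i) 0 ha ha0 (fun p => by
    have := sub_nonneg.2 (h p)
    rw [← Finset.sum_sub_distrib] at this
    refine this.trans_eq (Finset.sum_congr rfl fun i _ => ?_)
    split_ifs <;> simp)
  simp only [mul_sub, Finset.sum_sub_distrib, zero_mul] at this
  linarith

/-- Rearrangement inequality for doubly substochastic arrays. -/
theorem sum_mul_mul_substochastic_le {s m : ℕ} (hs : s ≤ m) (a : Fin s → ℝ) (b : Fin m → ℝ)
    (ha : Antitone a) (ha0 : ∀ i, 0 ≤ a i) (hb : Antitone b) (hb0 : ∀ k, 0 ≤ b k)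
    (M : Fin s → Fin m → ℝ) (hM0 : ∀ i k, 0 ≤ M i k)
    (hrow : ∀ i, ∑ k, M i k ≤ 1) (hcol : ∀ k, ∑ i, M i k ≤ 1) :
    ∑ i, a i * ∑ k, b k * M i k ≤ ∑ i, a i * b (Fin.castLE hs i) := by
  refine sum_mul_le_sum_mul_of_partial_sums_le a _ _ ha ha0 fun p => ?_
  have h1 : (∑ i : Fin s, if (i : ℕ) < p then ∑ k, b k * M i k else 0) =
      ∑ k, b k * ∑ i : Fin s, if (i : ℕ) < p then M i k else 0 := by
    simp only [Finset.mul_sum]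
    rw [Finset.sum_comm]
    refine Finset.sum_congr rfl fun i _ => ?_
    split_ifs <;> simp
  have h2 : (∑ i : Fin s, if (i : ℕ) < p then b (Fin.castLE hs i) else 0) =
      ∑ k : Fin m, b k * if (k : ℕ) < s then (if (k : ℕ) < p then 1 else 0) else 0 := by
    have := sum_castLE hs (fun k => if (k : ℕ) < p then b k else 0)
    simp only [Fin.val_castLE] at this
    rw [this]
    refine Finset.sum_congr rfl fun i _ => ?_
    split_ifs <;> simp
  rw [h1, h2]
  refine sum_mul_le_sum_mul_of_partial_sums_le b _ _ hb hb0 fun q => ?_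
  by_cases hq : q ≤ p ∧ q ≤ s
  · refine Finset.sum_le_sum fun k _ => ?_
    split_ifs with hk hks hkp
    · refine (Finset.sum_le_sum fun i _ => ?_).trans (hcol k)
      split_ifs
      exacts [le_rfl, hM0 i k]
    all_goals first | omega | exact le_rfl
  · calc (∑ k : Fin m, if (k : ℕ) < q then ∑ i : Fin s, if (i : ℕ) < p then M i k else 0 else 0)
        ≤ ∑ k : Fin m, ∑ i : Fin s, if (i : ℕ) < p then M i k else 0 := by
          refine Finset.sum_le_sum fun k _ => ?_
          split_ifs
          · exact le_rfl
          · refine Finset.sum_nonneg fun i _ => ?_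
            split_ifs
            exacts [hM0 i k, le_rfl]
      _ = ∑ i : Fin s, if (i : ℕ) < p then ∑ k, M i k else 0 := by
          rw [Finset.sum_comm]
          refine Finset.sum_congr rfl fun i _ => ?_
          split_ifs <;> simp
      _ ≤ ∑ i : Fin s, if (i : ℕ) < p then 1 else 0 := by
          refine Finset.sum_le_sum fun i _ => ?_
          split_ifs
          exacts [hrow i, le_rfl]
      _ = ∑ k : Fin m, if (k : ℕ) < s then (if (k : ℕ) < p then 1 else 0) else 0 :=
          sum_castLE hs (fun k => if (k : ℕ) < p then 1 else 0)
      _ ≤ _ := by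
          refine Finset.sum_le_sum fun k _ => ?_
          split_ifs <;> first | omega | norm_num

theorem eq_of_antitone_of_map_univ_eq {m : ℕ} {f g : Fin m → ℝ} (hf : Antitone f)
    (hg : Antitone g) (h : Finset.univ.val.map f = Finset.univ.val.map g) : f = g := by
  rw [Fin.univ_val_map, Fin.univ_val_map, Multiset.coe_eq_coe] at h
  exact List.ofFn_injective
    (h.eq_of_pairwise' hf.sortedGE_ofFn.pairwise hg.sortedGE_ofFn.pairwise)

theorem antitone_comp_sort_neg {m : ℕ} (f : Fin m → ℝ) :
    Antitone (f ∘ Tuple.sort (fun j => -f j)) := fun i j hij => by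
  simpa using Tuple.monotone_sort (fun j => -f j) hij

/-- Singular values are invariant under orthogonal changes of bases. -/
theorem singularValues_orthogonal_mul_mul {m n : ℕ} (A : Matrix (Fin m) (Fin n) ℝ)
    (U : Matrix (Fin m) (Fin m) ℝ) (V : Matrix (Fin n) (Fin n) ℝ)
    (hU : Uᵀ * U = 1) (hV : V * Vᵀ = 1) :
    singularValues (U * A * V) = singularValues A := by
  have key : (Matrix.isHermitian_mul_conjTranspose_self (U * A * V)).eigenvalues =
      (Matrix.isHermitian_mul_conjTranspose_self A).eigenvalues := by
    rw [Matrix.IsHermitian.eigenvalues_eq_eigenvalues_iff]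
    have : U * A * V * (U * A * V)ᴴ = U * (A * Aᴴ * Uᵀ) := by
      simp only [conjTranspose_eq_transpose_of_trivial, transpose_mul]
      calc U * A * V * (Vᵀ * (Aᵀ * Uᵀ)) = U * A * (V * Vᵀ) * (Aᵀ * Uᵀ) := by
            simp only [Matrix.mul_assoc]
        _ = _ := by rw [hV]; simp only [Matrix.mul_assoc, Matrix.one_mul]
    rw [this, Matrix.charpoly_mul_comm, Matrix.mul_assoc, hU, Matrix.mul_one]
  unfold singularValues
  rw [key]

theorem singularValues_of_diagonal {m n : ℕ} (A : Matrix (Fin m) (Fin n) ℝ)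
    (hoff : ∀ (i : Fin m) (j : Fin n), (i : ℕ) ≠ (j : ℕ) → A i j = 0)
    (h0 : ∀ i : Fin (min m n),
      0 ≤ A (Fin.castLE (min_le_left m n) i) (Fin.castLE (min_le_right m n) i))
    (hmono : ∀ i j : Fin (min m n), i ≤ j →
      A (Fin.castLE (min_le_left m n) j) (Fin.castLE (min_le_right m n) j)
        ≤ A (Fin.castLE (min_le_left m n) i) (Fin.castLE (min_le_right m n) i))
    (i : Fin (min m n)) :
    singularValues A i = A (Fin.castLE (min_le_left m n) i) (Fin.castLE (min_le_right m n) i) := by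
  set d : Fin m → ℝ := fun k => if h : (k : ℕ) < n then A k ⟨k, h⟩ ^ 2 else 0 with hd
  have hAA : A * Aᴴ = diagonal d := by
    ext k l
    simp only [conjTranspose_eq_transpose_of_trivial, mul_apply, transpose_apply, diagonal_apply]
    by_cases hk : (k : ℕ) < n
    · rw [Finset.sum_eq_single ⟨k, hk⟩]
      · split_ifs with hkl
        · subst hkl; simp [hd, hk, sq]
        · rw [hoff l, mul_zero]
          exact fun h => hkl (Fin.ext h.symm)
      · intro j _ hj
        rw [hoff k j, zero_mul]
        exact fun h => hj (Fin.ext h.symm)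
      · simp
    · rw [Finset.sum_eq_zero]
      · simp [hd, hk]
      · intro j _
        rw [hoff k j, zero_mul]
        omega
  have hd_anti : Antitone d := by
    intro k l hkl
    simp only [hd]
    have hkl' : (k : ℕ) ≤ l := hkl
    by_cases hl : (l : ℕ) < n
    · have hk : (k : ℕ) < n := by omega
      rw [dif_pos hl, dif_pos hk]
      exact pow_le_pow_left₀ (h0 ⟨l, lt_min l.2 hl⟩)
        (hmono ⟨k, lt_min k.2 hk⟩ ⟨l, lt_min l.2 hl⟩ hkl') 2
    · rw [dif_neg hl]
      split_ifs <;> positivity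
  set hA := Matrix.isHermitian_mul_conjTranspose_self A
  have hroots : Finset.univ.val.map d = Finset.univ.val.map hA.eigenvalues := by
    have h := hA.roots_charpoly_eq_eigenvalues
    have h' := congrArg (fun B => B.charpoly.roots) hAA
    simp only [charpoly_diagonal] at h'
    rw [Polynomial.roots_prod _ _
      (Finset.prod_ne_zero_iff.2 fun i _ => Polynomial.X_sub_C_ne_zero _)] at h'
    simp only [Polynomial.roots_X_sub_C, Multiset.bind_singleton] at h'
    exact h'.symm.trans h
  have hev : hA.eigenvalues ∘ Tuple.sort (fun j => -hA.eigenvalues j) = d := by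
    refine eq_of_antitone_of_map_univ_eq (antitone_comp_sort_neg _) hd_anti ?_
    rw [hroots, ← Multiset.map_map]
    congr 1
    simp
  have hi := congrFun hev (Fin.castLE (min_le_left m n) i)
  simp only [Function.comp_apply] at hi
  unfold singularValues
  rw [hi]
  have hin : (i : ℕ) < n := lt_of_lt_of_le i.2 (min_le_right m n)
  simp only [hd, Fin.val_castLE, dif_pos hin]
  exact Real.sqrt_sq (h0 i)

theorem frobNormSq_eq_trace {m n : ℕ} (A : Matrix (Fin m) (Fin n) ℝ) :
    frobNormSq A = (A * Aᵀ).trace := by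
  simp [frobNormSq, trace, mul_apply, sq]

theorem frobNormSq_orthogonal_mul_mul {m n : ℕ} (A : Matrix (Fin m) (Fin n) ℝ)
    (U : Matrix (Fin m) (Fin m) ℝ) (V : Matrix (Fin n) (Fin n) ℝ)
    (hU : Uᵀ * U = 1) (hV : V * Vᵀ = 1) :
    frobNormSq (U * A * V) = frobNormSq A := by
  rw [frobNormSq_eq_trace, frobNormSq_eq_trace]
  have : U * A * V * (U * A * V)ᵀ = U * (A * Aᵀ * Uᵀ) := by
    simp only [transpose_mul]
    calc U * A * V * (Vᵀ * (Aᵀ * Uᵀ)) = U * A * (V * Vᵀ) * (Aᵀ * Uᵀ) := by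
          simp only [Matrix.mul_assoc]
      _ = _ := by rw [hV]; simp only [Matrix.mul_assoc, Matrix.one_mul]
  rw [this, trace_mul_comm, Matrix.mul_assoc, hU, Matrix.mul_one]

/-- If the rows of `V` are orthogonal of norm `0` or `1`, then its columns have norm at most `1`. -/
theorem sum_col_sq_le_one {m n : ℕ} (V : Matrix (Fin m) (Fin n) ℝ)
    (hV : V * Vᵀ * V = V) (j : Fin n) : ∑ k, V k j ^ 2 ≤ 1 := by
  set G := Vᵀ * V with hG
  have hGG : G * Gᵀ = G := by
    rw [hG, transpose_mul, transpose_transpose, Matrix.mul_assoc, ← Matrix.mul_assoc V, hV]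
  have h1 : ∑ k, V k j ^ 2 = G j j := by
    simp [hG, mul_apply, sq]
  have h2 : G j j ^ 2 ≤ G j j := by
    calc G j j ^ 2 ≤ ∑ l, G j l ^ 2 :=
          Finset.single_le_sum (f := fun l => G j l ^ 2) (fun l _ => sq_nonneg _)
            (Finset.mem_univ j)
      _ = (G * Gᵀ) j j := by simp [mul_apply, sq]
      _ = G j j := by rw [hGG]
  rw [h1]
  nlinarith

/-- A singular value decomposition in which the right singular vectors belonging to the singular
value `0` are replaced by `0`. -/
theorem exists_svd {m n : ℕ} (X : Matrix (Fin m) (Fin n) ℝ) :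
    ∃ (P : Matrix (Fin m) (Fin m) ℝ) (μ : Fin m → ℝ) (V : Matrix (Fin m) (Fin n) ℝ),
      Antitone μ ∧ (∀ k, 0 ≤ μ k) ∧
      (∀ i, singularValues X i = μ (Fin.castLE (min_le_left m n) i)) ∧
      (∀ i j, X i j = ∑ k, μ k * (P i k * V k j)) ∧
      (∀ k, ∑ i, P i k ^ 2 ≤ 1) ∧ (∀ i, ∑ k, P i k ^ 2 ≤ 1) ∧
      (∀ k, ∑ j, V k j ^ 2 ≤ 1) ∧ (∀ j, ∑ k, V k j ^ 2 ≤ 1) ∧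
      frobNormSq X = ∑ k, μ k ^ 2 := by
  set hX := Matrix.isHermitian_mul_conjTranspose_self X
  set τ := Tuple.sort (fun j => -hX.eigenvalues j)
  set Q : Matrix (Fin m) (Fin m) ℝ := ↑hX.eigenvectorUnitary with hQ
  set P : Matrix (Fin m) (Fin m) ℝ := Q.submatrix id τ with hP
  set μ : Fin m → ℝ := fun k => Real.sqrt (hX.eigenvalues (τ k)) with hμ
  have hev0 : ∀ k, 0 ≤ hX.eigenvalues k :=
    (Matrix.posSemidef_self_mul_conjTranspose X).eigenvalues_nonneg
  have hμsq : ∀ k, μ k ^ 2 = hX.eigenvalues (τ k) := fun k => Real.sq_sqrt (hev0 _)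
  have hQ1 : Qᵀ * Q = 1 := by
    simpa [star_eq_conjTranspose, hQ] using Unitary.coe_star_mul_self hX.eigenvectorUnitary
  have hP1 : Pᵀ * P = 1 := by
    calc Pᵀ * P = (Qᵀ * Q).submatrix τ τ := rfl
      _ = 1 := by rw [hQ1, submatrix_one_equiv]
  have hP2 : P * Pᵀ = 1 := mul_eq_one_comm.1 hP1
  have hspec : Qᵀ * (X * Xᵀ) * Q = diagonal hX.eigenvalues := by
    have := hX.conjStarAlgAut_star_eigenvectorUnitary
    rw [Unitary.conjStarAlgAut_apply] at this
    simpa [star_eq_conjTranspose, hQ] using this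
  have hPspec : Pᵀ * (X * Xᵀ) * P = diagonal (fun k => μ k ^ 2) := by
    calc Pᵀ * (X * Xᵀ) * P = (Qᵀ * (X * Xᵀ) * Q).submatrix τ τ := rfl
      _ = diagonal (fun k => μ k ^ 2) := by
        rw [hspec, submatrix_diagonal_equiv]
        exact congrArg diagonal (funext fun k => (hμsq k).symm)
  set B := Pᵀ * X with hB
  have hBB : B * Bᵀ = diagonal (fun k => μ k ^ 2) := by
    rw [← hPspec, hB, transpose_mul, transpose_transpose]
    simp only [Matrix.mul_assoc]
  set V : Matrix (Fin m) (Fin n) ℝ := diagonal (fun k => (μ k)⁻¹) * B with hV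
  have hBV : diagonal μ * V = B := by
    ext k j
    rw [hV, diagonal_mul, diagonal_mul]
    by_cases hk : μ k = 0
    · have h := congrFun (congrFun hBB k) k
      simp only [mul_apply, transpose_apply, diagonal_apply_eq, hk] at h
      have h' := (Finset.sum_eq_zero_iff_of_nonneg (fun j _ => mul_self_nonneg (B k j))).1
        (h.trans (by norm_num)) j (Finset.mem_univ j)
      simp [mul_self_eq_zero.1 h', hk]
    · rw [mul_inv_cancel_left₀ hk]
  have hVV : V * Vᵀ = diagonal (fun k => (μ k)⁻¹ * μ k) := by
    rw [hV, transpose_mul, diagonal_transpose, Matrix.mul_assoc, ← Matrix.mul_assoc B, hBB,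
      diagonal_mul_diagonal, diagonal_mul_diagonal]
    congr 1
    ext k
    by_cases hk : μ k = 0
    · simp [hk]
    · field_simp
  have hVVV : V * Vᵀ * V = V := by
    rw [hVV, hV]
    ext k j
    simp only [diagonal_mul]
    by_cases hk : μ k = 0
    · simp [hk]
    · field_simp
  have hXP : X = P * (diagonal μ * V) := by
    rw [hBV, hB, ← Matrix.mul_assoc, hP2, Matrix.one_mul]
  refine ⟨P, μ, V, ?_, fun k => Real.sqrt_nonneg _, fun i => rfl, ?_, ?_, ?_, ?_, ?_, ?_⟩
  · intro k l hkl
    exact Real.sqrt_le_sqrt (antitone_comp_sort_neg hX.eigenvalues hkl)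
  · intro i j
    conv_lhs => rw [hXP, mul_apply]
    refine Finset.sum_congr rfl fun k _ => ?_
    rw [diagonal_mul]
    ring
  · intro k
    have := congrFun (congrFun hP1 k) k
    simp only [mul_apply, transpose_apply, one_apply_eq] at this
    simp only [sq, this, le_refl]
  · intro k
    have := congrFun (congrFun hP2 k) k
    simp only [mul_apply, transpose_apply, one_apply_eq] at this
    simp only [sq, this, le_refl]
  · intro k
    have := congrFun (congrFun hVV k) k
    simp only [mul_apply, transpose_apply, diagonal_apply_eq] at this
    simp only [sq, this]
    exact inv_mul_le_one
  · exact sum_col_sq_le_one V hVVV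
  · have h := congrArg trace hBB
    rw [← frobNormSq_eq_trace, trace_diagonal] at h
    rw [← h, hB, ← Matrix.mul_one (Pᵀ * X)]
    exact (frobNormSq_orthogonal_mul_mul X Pᵀ 1 (by simpa using hP2) (by simp)).symm

theorem sum_sq_singularValues_le_frobNormSq {m n : ℕ} (X : Matrix (Fin m) (Fin n) ℝ) :
    ∑ i, singularValues X i ^ 2 ≤ frobNormSq X := by
  obtain ⟨P, μ, V, -, -, hσ, -, -, -, -, -, hF⟩ := exists_svd X
  simp only [hσ, hF]
  exact sum_castLE_le (min_le_left m n) (fun k => μ k ^ 2) fun k => sq_nonneg _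

/-- Von Neumann's trace inequality against the diagonal. -/
theorem sum_mul_diag_le_sum_mul_singularValues {m n : ℕ} (X : Matrix (Fin m) (Fin n) ℝ)
    (a : Fin (min m n) → ℝ) (ha : Antitone a) (ha0 : ∀ i, 0 ≤ a i) :
    ∑ i, a i * X (Fin.castLE (min_le_left m n) i) (Fin.castLE (min_le_right m n) i) ≤
      ∑ i, a i * singularValues X i := by
  obtain ⟨P, μ, V, hμ, hμ0, hσ, hX, hP1, hP2, hV1, hV2, -⟩ := exists_svd X
  simp only [hσ]
  refine le_trans ?_ (sum_mul_mul_substochastic_le (min_le_left m n) a μ ha ha0 hμ hμ0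
    (fun i k => (P (Fin.castLE (min_le_left m n) i) k ^ 2 +
      V k (Fin.castLE (min_le_right m n) i) ^ 2) / 2) ?_ ?_ ?_)
  · refine Finset.sum_le_sum fun i _ => mul_le_mul_of_nonneg_left ?_ (ha0 i)
    rw [hX]
    refine Finset.sum_le_sum fun k _ => mul_le_mul_of_nonneg_left ?_ (hμ0 k)
    nlinarith [sq_nonneg (P (Fin.castLE (min_le_left m n) i) k -
      V k (Fin.castLE (min_le_right m n) i))]
  · intro i k
    positivity
  · intro i
    rw [← Finset.sum_div, Finset.sum_add_distrib]
    linarith [hP2 (Fin.castLE (min_le_left m n) i), hV2 (Fin.castLE (min_le_right m n) i)]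
  · intro k
    rw [← Finset.sum_div, Finset.sum_add_distrib]
    linarith [(sum_castLE_le (min_le_left m n) (fun i => P i k ^ 2) fun i => sq_nonneg _).trans
        (hP1 k),
      (sum_castLE_le (min_le_right m n) (fun j => V k j ^ 2) fun i => sq_nonneg _).trans (hV1 k)]

theorem shrink_objective_le {l s x : ℝ} (hx : 0 ≤ x) :
    l * max (s - l) 0 + 1 / 2 * (max (s - l) 0 - s) ^ 2 ≤ l * x + 1 / 2 * x ^ 2 - s * x
      + 1 / 2 * s ^ 2 := by
  rcases le_total (s - l) 0 with h | h
  · rw [max_eq_right h]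
    nlinarith [mul_nonneg hx (neg_nonneg.2 h), sq_nonneg x]
  · rw [max_eq_left h]
    nlinarith [sq_nonneg (x - (s - l))]

/-- Weighted singular value thresholding: if `Y = U Σ Vᵀ` is an SVD of `Y`, `λ > 0`, and
`0 ≤ w₁ ≤ ⋯ ≤ w_s` (`s = min(m,n)`), then `D = U 𝒮_{λw}(Σ) Vᵀ` is a global minimizer of
`X ↦ λ·Σᵢ wᵢ·σᵢ(X) + (1/2)·‖X − Y‖_F²`. -/
theorem weighted_svt_minimizer {m n : ℕ}
    (Y : Matrix (Fin m) (Fin n) ℝ)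
    (U : Matrix (Fin m) (Fin m) ℝ) (V : Matrix (Fin n) (Fin n) ℝ)
    (Sig : Matrix (Fin m) (Fin n) ℝ)
    (lam : ℝ) (w : Fin (min m n) → ℝ)
    (hU : Uᵀ * U = 1) (hU' : U * Uᵀ = 1)
    (hV : Vᵀ * V = 1) (hV' : V * Vᵀ = 1)
    (hY : Y = U * Sig * Vᵀ)
    (hSigOff : ∀ (i : Fin m) (j : Fin n), (i : ℕ) ≠ (j : ℕ) → Sig i j = 0)
    (hSigNonneg : ∀ i : Fin (min m n),
      0 ≤ Sig (Fin.castLE (min_le_left m n) i) (Fin.castLE (min_le_right m n) i))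
    (hSigMono : ∀ i j : Fin (min m n), i ≤ j →
      Sig (Fin.castLE (min_le_left m n) j) (Fin.castLE (min_le_right m n) j)
        ≤ Sig (Fin.castLE (min_le_left m n) i) (Fin.castLE (min_le_right m n) i))
    (hlam : 0 < lam)
    (hw0 : ∀ i, 0 ≤ w i)
    (hwMono : ∀ i j : Fin (min m n), i ≤ j → w i ≤ w j)
    (SigThresh : Matrix (Fin m) (Fin n) ℝ)
    (hSigThresh : ∀ (i : Fin m) (j : Fin n),
      SigThresh i j =
        if h : (i : ℕ) = (j : ℕ) then
          max (Sig i j - lam * w ⟨(i : ℕ), by omega⟩) 0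
        else 0)
    (D : Matrix (Fin m) (Fin n) ℝ)
    (hD : D = U * SigThresh * Vᵀ) :
    ∀ X : Matrix (Fin m) (Fin n) ℝ,
      lam * (∑ i, w i * singularValues D i) + (1 / 2) * frobNormSq (D - Y)
        ≤ lam * (∑ i, w i * singularValues X i) + (1 / 2) * frobNormSq (X - Y) := by
  intro X
  set S : Fin (min m n) → ℝ := fun i =>
    Sig (Fin.castLE (min_le_left m n) i) (Fin.castLE (min_le_right m n) i) with hS
  set t : Fin (min m n) → ℝ := fun i => max (S i - lam * w i) 0 with ht
  have htdiag : ∀ i, SigThresh (Fin.castLE (min_le_left m n) i)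
      (Fin.castLE (min_le_right m n) i) = t i := fun i => by
    exact (hSigThresh _ _).trans (dif_pos rfl)
  have htoff : ∀ (i : Fin m) (j : Fin n), (i : ℕ) ≠ (j : ℕ) → SigThresh i j = 0 :=
    fun i j hij => by rw [hSigThresh, dif_neg hij]
  have hDt : ∀ i, singularValues D i = t i := fun i => by
    rw [hD, singularValues_orthogonal_mul_mul _ U Vᵀ hU (by simpa using hV),
      singularValues_of_diagonal SigThresh htoff, htdiag]
    · intro i
      rw [htdiag]
      exact le_max_right _ _
    · intro i j hij
      rw [htdiag, htdiag]
      exact max_le_max_right 0 (sub_le_sub (hSigMono i j hij)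
        (mul_le_mul_of_nonneg_left (hwMono i j hij) hlam.le))
  have hDF : frobNormSq (D - Y) = ∑ i, (t i - S i) ^ 2 := by
    rw [hD, hY, ← Matrix.sub_mul, ← Matrix.mul_sub,
      frobNormSq_orthogonal_mul_mul _ U Vᵀ hU (by simpa using hV), frobNormSq,
      sum_sum_eq_sum_diag]
    · simp only [Matrix.sub_apply, htdiag, hS]
    · intro i j hij
      simp [htoff i j hij, hSigOff i j hij]
  set Z := Uᵀ * X * V with hZ
  have hZX : X = U * Z * Vᵀ := by
    calc X = U * Uᵀ * X * (V * Vᵀ) := by simp [hU', hV']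
      _ = U * Z * Vᵀ := by simp only [hZ, Matrix.mul_assoc]
  have hXσ : singularValues X = singularValues Z := by
    rw [hZX, singularValues_orthogonal_mul_mul _ U Vᵀ hU (by simpa using hV)]
  have hXF : frobNormSq (X - Y) = frobNormSq Z - 2 * ∑ i, S i *
      Z (Fin.castLE (min_le_left m n) i) (Fin.castLE (min_le_right m n) i) + ∑ i, S i ^ 2 := by
    rw [hZX, hY, ← Matrix.sub_mul, ← Matrix.mul_sub,
      frobNormSq_orthogonal_mul_mul _ U Vᵀ hU (by simpa using hV)]
    have h1 := sum_sum_eq_sum_diag (fun i j => Sig i j * Z i j)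
      (fun (i : Fin m) (j : Fin n) hij => by simp [hSigOff i j hij])
    have h2 := sum_sum_eq_sum_diag (fun i j => Sig i j ^ 2)
      (fun (i : Fin m) (j : Fin n) hij => by simp [hSigOff i j hij])
    simp only [hS]
    rw [← h1, ← h2, frobNormSq, frobNormSq]
    simp only [Finset.mul_sum, ← Finset.sum_sub_distrib, ← Finset.sum_add_distrib, Matrix.sub_apply]
    refine Finset.sum_congr rfl fun i _ => Finset.sum_congr rfl fun j _ => ?_
    ring
  have hvN := sum_mul_diag_le_sum_mul_singularValues Z S (fun i j hij => hSigMono i j hij) hSigNonneg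
  have hfro := sum_sq_singularValues_le_frobNormSq Z
  have hscalar : ∑ i, (lam * w i * t i + 1 / 2 * (t i - S i) ^ 2) ≤
      ∑ i, (lam * w i * singularValues Z i + 1 / 2 * singularValues Z i ^ 2
        - S i * singularValues Z i + 1 / 2 * S i ^ 2) :=
    Finset.sum_le_sum fun i _ => shrink_objective_le (Real.sqrt_nonneg _)
  simp only [Finset.sum_add_distrib, Finset.sum_sub_distrib, mul_assoc, ← Finset.mul_sum]
    at hscalar
  simp only [hDt, hDF, hXσ, hXF]
  linarith
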